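/- Let P ∈ ℙ¹(k̄) be a point of degree 2, i.e. σ(P) ≠ P and σ²(P) = P, and set X = ℙ¹(k̄) \ {P, σ(P)}. Let a(n) be the number of n-element subsets S ⊆ X with σ(S) = S. Then for n > 0: a(n) = ((q + 1)/(q² + 1)) · ((q − 1) q^n + (−1)^{(n−1)/2} (q + 1)) if n is odd, and a(n) = ((q² − 1)/(q² + 1)) · (q^n − (−1)^{n/2}) if n is even. -/

import Mathlib

/-- The `q`-power Frobenius acting on `ℙ^{m-1}(k̄)` (raising homogeneous
coordinates to the `q`-th power), where `q = |k|`. -/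
noncomputable def projFrob (k : Type*) [Field k] [Fintype k] (m : ℕ) :
    Projectivization (AlgebraicClosure k) (Fin m → AlgebraicClosure k) →
    Projectivization (AlgebraicClosure k) (Fin m → AlgebraicClosure k) :=
  fun P => Projectivization.mk (AlgebraicClosure k)
    (fun i => (P.rep i) ^ (Fintype.card k)) (by
      intro h
      apply P.rep_nonzero
      funext i
      have hi : P.rep i ^ (Fintype.card k) = 0 := by simpa using congrFun h i
      simpa using pow_eq_zero_iff (Fintype.card_ne_zero (α := k)) |>.mp hi)

/-- The number of `n`-element subsets `S` of `A ⊆ X` with `σ(S) = S`. -/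
noncomputable def nSetCount {X : Type*} (σ : X → X) (A : Set X) (n : ℕ) : ℕ :=
  Set.ncard {S : Set X | S ⊆ A ∧ S.Finite ∧ S.ncard = n ∧ σ '' S = S}

section aux
open Polynomial

theorem aux_fixed_mem_range (k : Type*) [Field k] [Fintype k] (K : Type*) [Field K] [Algebra k K]
    (x : K) (hx : x ^ Fintype.card k = x) : x ∈ Set.range (algebraMap k K) := by
  have hs : (X ^ Fintype.card k - X : k[X]).Splits := by
    rw [splits_iff_card_roots, FiniteField.roots_X_pow_card_sub_X,
      FiniteField.X_pow_card_sub_X_natDegree_eq k Fintype.one_lt_card]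
    simp
  have h1 := hs.roots_map_of_injective (algebraMap k K).injective
  have h2 : x ∈ (map (algebraMap k K) (X ^ Fintype.card k - X : k[X])).roots := by
    rw [mem_roots]
    · simp [hx]
    · rw [Polynomial.map_ne_zero_iff (algebraMap k K).injective]
      exact FiniteField.X_pow_card_sub_X_ne_zero k Fintype.one_lt_card
  rw [h1] at h2
  obtain ⟨y, -, hy⟩ := Multiset.mem_map.1 h2
  exact ⟨y, hy⟩

/-- stable multisets -/
def auxM {X : Type*} (σ : X → X) (n : ℕ) : Set (Multiset X) :=
  {s | s.map σ = s ∧ s.card = n}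

theorem aux_monic_card (k : Type*) [Field k] [Fintype k] (n : ℕ) :
    {f : k[X] | f.Monic ∧ f.natDegree = n}.Finite ∧
    {f : k[X] | f.Monic ∧ f.natDegree = n}.ncard = Fintype.card k ^ n := by
  have e := (monicEquivDegreeLT (R := k) n).trans (degreeLTEquiv k n).toEquiv
  constructor
  · exact Set.finite_coe_iff.1 (Finite.of_equiv _ e.symm)
  · rw [← Nat.card_coe_set_eq]
    exact (Nat.card_congr e).trans (by simp)

theorem aux_M_card (k : Type*) [Field k] [Fintype k] (K : Type*) [Field K] [Algebra k K]
    [IsAlgClosed K] (n : ℕ) :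
    (auxM (fun x : K => x ^ Fintype.card k) n).Finite ∧
    (auxM (fun x : K => x ^ Fintype.card k) n).ncard = Fintype.card k ^ n := by
  have him : auxM (fun x : K => x ^ Fintype.card k) n =
      (fun f : k[X] => (f.map (algebraMap k K)).roots) '' {f : k[X] | f.Monic ∧ f.natDegree = n} := by
    ext s
    constructor
    · rintro ⟨h1, h2⟩
      have hl : (s.map fun a => X - C a).prod ∈ lifts (algebraMap k K) := by
        rw [lifts_iff_coeff_lifts]
        intro i
        apply aux_fixed_mem_range
        have : ((s.map fun a => X - C a).prod).map (FiniteField.frobeniusAlgHom k K : K →+* K)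
            = (s.map fun a => X - C a).prod := by
          rw [Polynomial.map_multiset_prod, Multiset.map_map]
          conv_rhs => rw [← h1, Multiset.map_map]
          simp
        have := congrArg (fun p => coeff p i) this
        simpa [coeff_map] using this
      obtain ⟨f, hf1, hf2, hf3⟩ := lifts_and_natDegree_eq_and_monic hl
        (monic_multisetProd_X_sub_C s)
      refine ⟨f, ⟨hf3, ?_⟩, ?_⟩
      · rw [hf2, natDegree_multiset_prod_X_sub_C_eq_card, h2]
      · simp only [hf1, roots_multiset_prod_X_sub_C]
    · rintro ⟨f, ⟨h1, h2⟩, rfl⟩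
      have hs := IsAlgClosed.splits (f.map (algebraMap k K))
      constructor
      · have := hs.roots_map_of_injective (FiniteField.frobeniusAlgHom k K : K →+* K).injective
        rw [Polynomial.map_map, AlgHom.comp_algebraMap] at this
        exact this.symm
      · rw [← hs.natDegree_eq_card_roots, natDegree_map, h2]
  have hinj : Set.InjOn (fun f : k[X] => (f.map (algebraMap k K)).roots)
      {f : k[X] | f.Monic ∧ f.natDegree = n} := by
    rintro f ⟨hf, -⟩ g ⟨hg, -⟩ h
    apply Polynomial.map_injective _ (algebraMap k K).injective
    rw [(IsAlgClosed.splits (f.map (algebraMap k K))).eq_prod_roots_of_monic (hf.map _),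
      (IsAlgClosed.splits (g.map (algebraMap k K))).eq_prod_roots_of_monic (hg.map _)]
    simp only at h
    rw [h]
  obtain ⟨h1, h2⟩ := aux_monic_card k n
  rw [him, hinj.ncard_image, h2]
  exact ⟨h1.image _, rfl⟩

/-- stable finsets -/
def auxB {X : Type*} (σ : X → X) (n : ℕ) : Set (Finset X) :=
  {s | s.val.map σ = s.val ∧ s.card = n}

theorem aux_decomp {X : Type*} [DecidableEq X] (m : Multiset X) :
    ∃ (g : Multiset X) (S : Finset X), g + g + S.val = m := by
  induction m using Multiset.induction_on with
  | empty => exact ⟨0, ∅, rfl⟩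
  | cons a m ih =>
    obtain ⟨g, S, rfl⟩ := ih
    by_cases ha : a ∈ S
    · refine ⟨a ::ₘ g, S.erase a, ?_⟩
      have : S.val = a ::ₘ (S.erase a).val := by
        rw [Finset.erase_val, Multiset.cons_erase ha]
      rw [this]
      ext x
      simp [Multiset.count_cons]
    · refine ⟨g, S.cons a ha, ?_⟩
      rw [Finset.cons_val, Multiset.add_cons]

theorem aux_decomp_inj {X : Type*} [DecidableEq X] {g g' : Multiset X} {S S' : Finset X}
    (h : g + g + S.val = g' + g' + S'.val) : g = g' ∧ S = S' := by
  have key : ∀ x, g.count x = g'.count x ∧ S.val.count x = S'.val.count x := by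
    intro x
    have := congrArg (Multiset.count x) h
    simp only [Multiset.count_add] at this
    have h1 := Multiset.nodup_iff_count_le_one.1 S.nodup x
    have h2 := Multiset.nodup_iff_count_le_one.1 S'.nodup x
    omega
  exact ⟨Multiset.ext.2 fun x => (key x).1, Finset.val_injective (Multiset.ext.2 fun x => (key x).2)⟩

theorem aux_M_sum {X : Type*} (σ : X → X) (hσ : Function.Injective σ)
    (hM : ∀ n, (auxM σ n).Finite) (n : ℕ) :
    (auxB σ n).Finite ∧
    (auxM σ n).ncard = ∑ j ∈ Finset.range (n / 2 + 1), (auxM σ j).ncard * (auxB σ (n - 2 * j)).ncard := by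
  classical
  have hB : ∀ n, (auxB σ n).Finite := by
    intro n
    refine Set.Finite.of_finite_image (f := Finset.val) ((hM n).subset ?_)
      (Finset.val_injective.injOn)
    rintro _ ⟨s, ⟨h1, h2⟩, rfl⟩
    exact ⟨h1, h2⟩
  refine ⟨hB n, ?_⟩
  have him : auxM σ n = (fun p : Multiset X × Finset X => p.1 + p.1 + p.2.val) ''
      (⋃ j ∈ (Finset.range (n / 2 + 1) : Set ℕ), auxM σ j ×ˢ auxB σ (n - 2 * j)) := by
    ext m
    simp only [Set.mem_image, Set.mem_iUnion, Set.mem_prod, Prod.exists]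
    constructor
    · rintro ⟨h1, h2⟩
      obtain ⟨g, S, rfl⟩ := aux_decomp m
      have h3 : (g.map σ) + g.map σ + (S.map ⟨σ, hσ⟩).val = g + g + S.val := by
        simpa using h1
      obtain ⟨h4, h5⟩ := aux_decomp_inj h3
      simp only [Multiset.card_add, Finset.card_val] at h2
      refine ⟨g, S, ⟨g.card, ?_, ⟨h4, rfl⟩, ?_, ?_⟩, rfl⟩
      · simp; omega
      · conv_rhs => rw [← h5]
        simp
      · omega
    · rintro ⟨g, S, ⟨j, hj, ⟨h1, h2⟩, h3, h4⟩, rfl⟩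
      simp at hj
      refine ⟨by simp [h1, h3], ?_⟩
      simp [h2, h4]
      omega
  have hinj : Function.Injective (fun p : Multiset X × Finset X => p.1 + p.1 + p.2.val) := by
    rintro ⟨g, S⟩ ⟨g', S'⟩ h
    obtain ⟨rfl, rfl⟩ := aux_decomp_inj h
    rfl
  rw [him, Set.ncard_image_of_injective _ hinj, Set.Finite.ncard_biUnion (Finset.finite_toSet _)]
  · rw [finsum_mem_coe_finset]
    exact Finset.sum_congr rfl fun j _ => Set.ncard_prod
  · intro j _
    exact (hM j).prod (hB _)
  · intro i _ j _ hij
    rw [Function.onFun, Set.disjoint_left]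
    rintro ⟨g, S⟩ ⟨⟨_, h1⟩, _⟩ ⟨⟨_, h2⟩, _⟩
    exact hij (h1.symm.trans h2)

theorem aux_B_card {X : Type*} (σ : X → X) (hσ : Function.Injective σ) (q : ℕ)
    (hM : ∀ n, (auxM σ n).Finite) (hM' : ∀ n, (auxM σ n).ncard = q ^ n) :
    (auxB σ 0).ncard = 1 ∧ (auxB σ 1).ncard = q ∧
      ∀ n, (auxB σ (n + 2)).ncard + q ^ (n + 1) = q ^ (n + 2) := by
  have key := fun n => (aux_M_sum σ hσ hM n).2
  simp only [hM'] at key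
  refine ⟨by simpa using (key 0).symm, by simpa using (key 1).symm, fun n => ?_⟩
  rw [key (n + 2), show (n + 2) / 2 + 1 = (n / 2 + 1) + 1 by omega, Finset.sum_range_succ',
    pow_succ' q n, key n, Finset.mul_sum]
  simp only [pow_zero, one_mul, mul_zero, Nat.sub_zero]
  rw [add_comm]
  congr 1
  refine Finset.sum_congr rfl fun j _ => ?_
  rw [show n + 2 - 2 * (j + 1) = n - 2 * j by omega]
  ring
end aux

/-- stable sets -/
def auxNS {X : Type*} (σ : X → X) (A : Set X) (n : ℕ) : Set (Set X) :=
  {S : Set X | S ⊆ A ∧ S.Finite ∧ S.ncard = n ∧ σ '' S = S}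

theorem aux_NS_univ {X : Type*} (σ : X → X) (hσ : Function.Injective σ) (n : ℕ) :
    auxNS σ Set.univ n = (fun s : Finset X => (s : Set X)) '' auxB σ n := by
  have key : ∀ s : Finset X, σ '' (s : Set X) = s ↔ s.val.map σ = s.val := by
    intro s
    have h1 : ((s.map ⟨σ, hσ⟩ : Finset X) : Set X) = σ '' (s : Set X) := by simp
    have h2 : (s.map ⟨σ, hσ⟩).val = s.val.map σ := by simp
    rw [← h1, ← h2, Finset.coe_inj, Finset.val_inj]
  ext S
  constructor
  · rintro ⟨-, h1, h2, h3⟩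
    lift S to Finset X using h1
    exact ⟨S, ⟨(key S).1 h3, by simpa using h2⟩, rfl⟩
  · rintro ⟨s, ⟨h1, h2⟩, rfl⟩
    exact ⟨Set.subset_univ _, s.finite_toSet, by simpa using h2, (key s).2 h1⟩

theorem aux_NS_range {X Y : Type*} (φ : X → X) (σ : Y → Y) (ι : X → Y)
    (hι : Function.Injective ι) (hc : ∀ x, σ (ι x) = ι (φ x)) (n : ℕ) :
    auxNS σ (Set.range ι) n = (fun S => ι '' S) '' auxNS φ Set.univ n := by
  have key : ∀ T : Set X, σ '' (ι '' T) = ι '' (φ '' T) := by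
    intro T
    rw [Set.image_image, Set.image_image]
    simp only [hc]
  ext S
  constructor
  · rintro ⟨h0, h1, h2, h3⟩
    obtain ⟨T, rfl⟩ := Set.subset_range_iff_exists_image_eq.1 h0
    refine ⟨T, ⟨Set.subset_univ _, Set.Finite.of_finite_image h1 hι.injOn, ?_, ?_⟩, rfl⟩
    · rwa [Set.ncard_image_of_injective _ hι] at h2
    · rw [key] at h3
      exact hι.image_injective h3
  · rintro ⟨T, ⟨-, h1, h2, h3⟩, rfl⟩
    refine ⟨Set.image_subset_range _ _, h1.image _, ?_, ?_⟩
    · simpa only [Set.ncard_image_of_injective _ hι] using h2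
    · simp only [key, h3]

theorem aux_orbit_mem {X : Type*} (σ : X → X) (hσ : Function.Injective σ) (A O : Set X)
    (hO : O.Finite) (hOσ : σ '' O = O) (hd : Disjoint A O)
    (hdich : ∀ S, σ '' S = S → O ⊆ S ∨ Disjoint S O) (n : ℕ) (S : Set X) :
    S ∈ auxNS σ (A ∪ O) n ↔ S ∈ auxNS σ A n ∨
      ∃ T j, T ∈ auxNS σ A j ∧ j + O.ncard = n ∧ T ∪ O = S := by
  constructor
  · rintro ⟨h0, h1, h2, h3⟩
    rcases hdich S h3 with h | h
    · right
      refine ⟨S \ O, (S \ O).ncard, ⟨?_, h1.subset Set.sdiff_subset, rfl, ?_⟩, ?_, ?_⟩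
      · rintro x ⟨hx, hx'⟩
        exact (h0 hx).resolve_right hx'
      · rw [Set.image_sdiff hσ, h3, hOσ]
      · rw [Set.ncard_sdiff_add_ncard_of_subset h h1, h2]
      · exact Set.sdiff_union_of_subset h
    · left
      refine ⟨?_, h1, h2, h3⟩
      intro x hx
      exact (h0 hx).resolve_right (Set.disjoint_left.1 h hx)
  · rintro (⟨h0, h1, h2, h3⟩ | ⟨T, j, ⟨h0, h1, h2, h3⟩, hj, rfl⟩)
    · exact ⟨h0.trans Set.subset_union_left, h1, h2, h3⟩
    · refine ⟨Set.union_subset_union_left _ h0, h1.union hO, ?_, ?_⟩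
      · rw [Set.ncard_union_eq (hd.mono_left h0) h1 hO, h2, hj]
      · rw [Set.image_union, h3, hOσ]

theorem aux_orbit {X : Type*} (σ : X → X) (hσ : Function.Injective σ) (A O : Set X)
    (hO : O.Finite) (hOne : O.Nonempty) (hOσ : σ '' O = O) (hd : Disjoint A O)
    (hdich : ∀ S, σ '' S = S → O ⊆ S ∨ Disjoint S O) (hfin : ∀ n, (auxNS σ A n).Finite) :
    (∀ n, (auxNS σ (A ∪ O) n).Finite) ∧
    (∀ n, n < O.ncard → (auxNS σ (A ∪ O) n).ncard = (auxNS σ A n).ncard) ∧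
    (∀ n, (auxNS σ (A ∪ O) (n + O.ncard)).ncard =
      (auxNS σ A (n + O.ncard)).ncard + (auxNS σ A n).ncard) := by
  have hm := aux_orbit_mem σ hσ A O hO hOσ hd hdich
  have h1 : ∀ n, n < O.ncard → auxNS σ (A ∪ O) n = auxNS σ A n := by
    intro n hn
    ext S
    rw [hm]
    constructor
    · rintro (h | ⟨T, j, -, h, -⟩)
      · exact h
      · omega
    · exact Or.inl
  have h2 : ∀ n, auxNS σ (A ∪ O) (n + O.ncard) =
      auxNS σ A (n + O.ncard) ∪ (fun T => T ∪ O) '' auxNS σ A n := by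
    intro n
    ext S
    rw [hm]
    constructor
    · rintro (h | ⟨T, j, h, h', h''⟩)
      · exact Or.inl h
      · obtain rfl : j = n := by omega
        exact Or.inr ⟨T, h, h''⟩
    · rintro (h | ⟨T, h, h''⟩)
      · exact Or.inl h
      · exact Or.inr ⟨T, n, h, rfl, h''⟩
  refine ⟨fun n => ?_, fun n hn => by rw [h1 n hn], fun n => ?_⟩
  · rcases lt_or_ge n O.ncard with h | h
    · rw [h1 n h]; exact hfin n
    · obtain ⟨m, rfl⟩ := Nat.exists_eq_add_of_le' h
      rw [h2]
      exact (hfin _).union ((hfin _).image _)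
  · rw [h2, Set.ncard_union_eq _ (hfin _) ((hfin _).image _), Set.InjOn.ncard_image]
    · intro T hT T' hT' h
      have e : ∀ T ∈ auxNS σ A n, (T ∪ O) \ O = T := by
        intro T hT
        rw [Set.union_sdiff_right]
        exact (hd.mono_left hT.1).sdiff_eq_left
      rw [← e T hT, ← e T' hT']
      exact congrArg (· \ O) h
    · rw [Set.disjoint_left]
      rintro S hS ⟨T, hT, rfl⟩
      obtain ⟨x, hx⟩ := hOne
      exact Set.disjoint_left.1 hd (hS.1 (Or.inr hx)) hx

theorem aux_projFrob_mk (k : Type*) [Field k] [Fintype k] (m : ℕ)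
    (v : Fin m → AlgebraicClosure k) (hv : v ≠ 0) (hv' : (fun i => v i ^ Fintype.card k) ≠ 0) :
    projFrob k m (Projectivization.mk _ v hv) =
      Projectivization.mk _ (fun i => v i ^ Fintype.card k) hv' := by
  obtain ⟨a, ha⟩ := Projectivization.exists_smul_eq_mk_rep (AlgebraicClosure k) v hv
  unfold projFrob
  rw [Projectivization.mk_eq_mk_iff']
  refine ⟨(a : AlgebraicClosure k) ^ Fintype.card k, ?_⟩
  rw [← ha]
  funext i
  simp [Units.smul_def, mul_pow]

theorem aux_pow_inj (k : Type*) [Field k] [Fintype k] :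
    Function.Injective (fun x : AlgebraicClosure k => x ^ Fintype.card k) :=
  (FiniteField.frobeniusAlgHom k (AlgebraicClosure k)).injective

theorem aux_projFrob_inj (k : Type*) [Field k] [Fintype k] (m : ℕ) :
    Function.Injective (projFrob k m) := by
  intro P Q h
  unfold projFrob at h
  rw [Projectivization.mk_eq_mk_iff'] at h
  obtain ⟨a, ha⟩ := h
  obtain ⟨b, rfl⟩ := IsAlgClosed.exists_pow_nat_eq a (Fintype.card_pos (α := k))
  rw [← P.mk_rep, ← Q.mk_rep, Projectivization.mk_eq_mk_iff']
  refine ⟨b, ?_⟩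
  funext i
  apply aux_pow_inj k
  have := congrFun ha i
  simpa [mul_pow] using this

/-- counts on the projective line -/
theorem aux_line (k : Type*) [Field k] [Fintype k] :
    (∀ n, (auxNS (projFrob k 2) Set.univ n).Finite) ∧
    (auxNS (projFrob k 2) Set.univ 0).ncard = 1 ∧
    (auxNS (projFrob k 2) Set.univ 1).ncard = Fintype.card k + 1 ∧
    (auxNS (projFrob k 2) Set.univ 2).ncard = Fintype.card k ^ 2 ∧
    (∀ n, (auxNS (projFrob k 2) Set.univ (n + 3)).ncard + Fintype.card k ^ (n + 1) =
      Fintype.card k ^ (n + 3)) := by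
  have hM := aux_M_card k (AlgebraicClosure k)
  have hinj := aux_pow_inj k
  obtain ⟨b0, b1, b2⟩ := aux_B_card _ hinj (Fintype.card k) (fun n => (hM n).1) (fun n => (hM n).2)
  have hBf := fun n => (aux_M_sum _ hinj (fun n => (hM n).1) n).1
  let K := AlgebraicClosure k
  have hne : ∀ x : K, (![x, 1] : Fin 2 → K) ≠ 0 := fun x h => by
    simpa using congrFun h 1
  have hne' : (![1, 0] : Fin 2 → K) ≠ 0 := fun h => by
    simpa using congrFun h 0
  let ι : K → Projectivization K (Fin 2 → K) := fun x => Projectivization.mk K ![x, 1] (hne x)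
  let inf : Projectivization K (Fin 2 → K) := Projectivization.mk K ![1, 0] hne'
  have hιi : Function.Injective ι := by
    intro x y h
    obtain ⟨a, ha⟩ := (Projectivization.mk_eq_mk_iff' _ _ _ _ _).1 h
    have h0 := congrFun ha 0
    have h1 := congrFun ha 1
    simp at h0 h1
    rw [← h0, h1, one_mul]
  have hpow : ∀ v : Fin 2 → K, v ≠ 0 → (fun i => v i ^ Fintype.card k) ≠ 0 := by
    intro v hv h
    apply hv
    funext i
    have := congrFun h i
    simpa using this
  have hιc : ∀ x, projFrob k 2 (ι x) = ι (x ^ Fintype.card k) := by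
    intro x
    rw [aux_projFrob_mk k 2 _ (hne x) (hpow _ (hne x))]
    simp only [ι]
    congr 1
    funext i
    fin_cases i <;> simp
  have hinf : projFrob k 2 inf = inf := by
    rw [aux_projFrob_mk k 2 _ hne' (hpow _ hne')]
    simp only [inf]
    congr 1
    funext i
    fin_cases i <;> simp
  have hd : Disjoint (Set.range ι) {inf} := by
    rw [Set.disjoint_singleton_right]
    rintro ⟨x, hx⟩
    obtain ⟨a, ha⟩ := (Projectivization.mk_eq_mk_iff' _ _ _ _ _).1 hx
    have h1 := congrFun ha 1
    simp at h1
  have hcov : Set.range ι ∪ {inf} = Set.univ := by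
    rw [Set.eq_univ_iff_forall]
    intro Q
    induction Q using Projectivization.ind with
    | h v hv =>
    by_cases h1 : v 1 = 0
    · right
      refine (Projectivization.mk_eq_mk_iff' _ _ _ _ _).2 ⟨v 0, ?_⟩
      funext i
      fin_cases i <;> simp [h1]
    · left
      refine ⟨v 0 / v 1, (Projectivization.mk_eq_mk_iff' _ _ _ _ _).2 ⟨(v 1)⁻¹, ?_⟩⟩
      funext i
      fin_cases i
      · simp [div_eq_inv_mul]
      · simp [h1]
  have hcnt : ∀ n, (auxNS (projFrob k 2) (Set.range ι) n).Finite ∧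
      (auxNS (projFrob k 2) (Set.range ι) n).ncard =
        (auxB (fun x : AlgebraicClosure k => x ^ Fintype.card k) n).ncard := by
    intro n
    rw [aux_NS_range _ _ ι hιi hιc, aux_NS_univ _ hinj]
    refine ⟨((hBf n).image _).image _, ?_⟩
    rw [Set.ncard_image_of_injective _ hιi.image_injective,
      Set.ncard_image_of_injective _ Finset.coe_injective]
  obtain ⟨c1, c2, c3⟩ := aux_orbit (projFrob k 2) (aux_projFrob_inj k 2) (Set.range ι) {inf}
    (Set.finite_singleton _) (Set.singleton_nonempty _) (by rw [Set.image_singleton, hinf]) hd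
    (by
      intro S _
      rw [Set.singleton_subset_iff, Set.disjoint_singleton_right]
      exact Classical.em _) (fun n => (hcnt n).1)
  rw [hcov] at c1 c2 c3
  simp only [Set.ncard_singleton, (hcnt _).2] at c2 c3
  refine ⟨c1, ?_, ?_, ?_, ?_⟩
  · rw [c2 0 one_pos, b0]
  · rw [c3 0, b0, b1]
  · rw [c3 1, b1, ← b2 0]
    simp
  · intro n
    have h1 := c3 (n + 2)
    have h2 := b2 n
    have h3 := b2 (n + 1)
    rw [show n + 1 + 2 = n + 2 + 1 by ring, show n + 1 + 1 = n + 2 by ring] at h3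
    rw [show n + 3 = n + 2 + 1 by ring, h1]
    omega

theorem aux_arith (q : ℚ) (a : ℕ → ℚ) (h1 : a 1 = q + 1) (h2 : a 2 = q ^ 2 - 1)
    (h3 : ∀ n, a (n + 3) + a (n + 1) = q ^ (n + 3) - q ^ (n + 1)) (m : ℕ) :
    a (2 * m + 1) = ((q + 1) / (q ^ 2 + 1)) * ((q - 1) * q ^ (2 * m + 1) + (-1) ^ m * (q + 1)) ∧
    a (2 * m + 2) = ((q ^ 2 - 1) / (q ^ 2 + 1)) * (q ^ (2 * m + 2) - (-1) ^ (m + 1)) := by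
  have hq : q ^ 2 + 1 ≠ 0 := by positivity
  induction m with
  | zero =>
    simp only [mul_zero, zero_add, h1, h2]
    constructor <;> field_simp <;> ring
  | succ m ih =>
    obtain ⟨i1, i2⟩ := ih
    have e1 := h3 (2 * m)
    have e2 := h3 (2 * m + 1)
    rw [show 2 * m + 1 + 3 = 2 * (m + 1) + 2 by ring, show 2 * m + 1 + 1 = 2 * m + 2 by ring] at e2
    rw [show 2 * m + 3 = 2 * (m + 1) + 1 by ring] at e1
    rw [eq_sub_of_add_eq e1, eq_sub_of_add_eq e2, i1, i2]
    constructor <;> field_simp <;> ring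

/-- Let `P ∈ ℙ¹(k̄)` be a point of degree 2 (`σ(P) ≠ P`, `σ²(P) = P`) and
`X = ℙ¹(k̄) \ {P, σ(P)}`.  For `n > 0`, the number `a(n)` of `n`-element
subsets `S ⊆ X` with `σ(S) = S` equals
`((q+1)/(q²+1))((q−1)qⁿ + (−1)^{(n−1)/2}(q+1))` for `n` odd, and
`((q²−1)/(q²+1))(qⁿ − (−1)^{n/2})` for `n` even. -/
theorem stmt8 (k : Type*) [Field k] [Fintype k] (q n : ℕ)
    (hq : Fintype.card k = q) (hn : 0 < n)
    (P : Projectivization (AlgebraicClosure k) (Fin 2 → AlgebraicClosure k))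
    (hP1 : projFrob k 2 P ≠ P) (hP2 : projFrob k 2 (projFrob k 2 P) = P) :
    (Odd n →
      (nSetCount (projFrob k 2) ({P, projFrob k 2 P} : Set _)ᶜ n : ℚ) =
        (((q : ℚ) + 1) / ((q : ℚ) ^ 2 + 1)) *
          (((q : ℚ) - 1) * (q : ℚ) ^ n + (-1 : ℚ) ^ ((n - 1) / 2) * ((q : ℚ) + 1))) ∧
    (Even n →
      (nSetCount (projFrob k 2) ({P, projFrob k 2 P} : Set _)ᶜ n : ℚ) =
        (((q : ℚ) ^ 2 - 1) / ((q : ℚ) ^ 2 + 1)) *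
          ((q : ℚ) ^ n - (-1 : ℚ) ^ (n / 2))) := by
  subst hq
  obtain ⟨l0, l1, l2, l3, l4⟩ := aux_line k
  have hmem : ∀ S : Set (Projectivization (AlgebraicClosure k) (Fin 2 → AlgebraicClosure k)),
      projFrob k 2 '' S = S → ∀ Q, Q ∈ S → projFrob k 2 Q ∈ S := by
    intro S hS Q hQ
    rw [← hS]
    exact Set.mem_image_of_mem _ hQ
  obtain ⟨-, c2, c3⟩ := aux_orbit (projFrob k 2) (aux_projFrob_inj k 2)
    ({P, projFrob k 2 P} : Set _)ᶜ {P, projFrob k 2 P} (Set.toFinite _) ⟨P, by simp⟩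
    (by rw [Set.image_pair, hP2, Set.pair_comm]) disjoint_compl_left
    (by
      intro S hS
      have h1 := hmem S hS P
      have h2 := hmem S hS (projFrob k 2 P)
      rw [hP2] at h2
      by_cases h : P ∈ S
      · left
        rintro x (rfl | rfl)
        · exact h
        · exact h1 h
      · right
        rw [Set.disjoint_right]
        rintro x (rfl | rfl)
        · exact h
        · exact fun h' => h (h2 h'))
    (fun n => (l0 n).subset fun S hS => ⟨Set.subset_univ _, hS.2⟩)
  rw [Set.compl_union_self, Set.ncard_pair hP1.symm] at c2 c3
  have a0 := c2 0 (by norm_num)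
  have a1 := c2 1 (by norm_num)
  have a2 := c3 0
  have a3 := fun n => c3 (n + 1)
  rw [l1] at a0
  rw [l2] at a1
  rw [zero_add, l3, ← a0] at a2
  have key := aux_arith (Fintype.card k : ℚ)
    (fun n => (nSetCount (projFrob k 2) ({P, projFrob k 2 P} : Set _)ᶜ n : ℚ))
    (by
      have : (nSetCount (projFrob k 2) ({P, projFrob k 2 P} : Set _)ᶜ 1) = Fintype.card k + 1 :=
        a1.symm
      simp [this])
    (by
      have : Fintype.card k ^ 2 = (nSetCount (projFrob k 2) ({P, projFrob k 2 P} : Set _)ᶜ 2) + 1 :=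
        a2
      have := congrArg (Nat.cast (R := ℚ)) this
      push_cast at this
      linarith)
    (by
      intro n
      have h1 : (auxNS (projFrob k 2) Set.univ (n + 3)).ncard =
        (nSetCount (projFrob k 2) ({P, projFrob k 2 P} : Set _)ᶜ (n + 3)) +
        (nSetCount (projFrob k 2) ({P, projFrob k 2 P} : Set _)ᶜ (n + 1)) := a3 n
      have := l4 n
      rw [h1] at this
      have := congrArg (Nat.cast (R := ℚ)) this
      push_cast at this
      linarith)
  constructor
  · rintro ⟨m, rfl⟩
    rw [show (2 * m + 1 - 1) / 2 = m by omega]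
    exact (key m).1
  · rintro ⟨m, rfl⟩
    obtain ⟨m, rfl⟩ := Nat.exists_eq_succ_of_ne_zero (show m ≠ 0 by omega)
    rw [show (m.succ + m.succ) / 2 = m + 1 by omega, show m.succ + m.succ = 2 * m + 2 by omega]
    exact (key m).2
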